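/- arXiv:1507.04986 — 2 statements merged into one kernel-verified Lean document; each statement's English description precedes it below -/
import Mathlib

section
/- Let 0<β≤1 and 0<s<1 with 2s<β. There exists a constant C>0 depending only on s and β such that for every h>0 and every bounded function u : ℤ → ℝ with D_+u and D_−u bounded and both seminorms [D_+u]_{C_h^{0,β}}, [D_−u]_{C_h^{0,β}} finite, one has sup_j |(−Δ_h)^s u_j| + sup_j |D_+((−Δ_h)^s u)_j| + sup_j |D_−((−Δ_h)^s u)_j| + [D_+((−Δ_h)^s u)]_{C_h^{0,β−2s}} + [D_−((−Δ_h)^s u)]_{C_h^{0,β−2s}} ≤ C (sup_j |u_j| + sup_j |D_+u_j| + sup_j |D_−u_j| + [D_+u]_{C_h^{0,β}} + [D_−u]_{C_h^{0,β}}). -/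
open Real

/-- The kernel of the one-dimensional fractional discrete Laplacian. -/
noncomputable def Ks (s : ℝ) (m : ℤ) : ℝ :=
  if m = 0 then 0
  else 4 ^ s * Real.Gamma (1 / 2 + s) * Real.Gamma (|(m : ℝ)| - s) /
    (Real.sqrt Real.pi * |Real.Gamma (-s)| * Real.Gamma (|(m : ℝ)| + 1 + s))

/-- The fractional discrete Laplacian on the mesh `hℤ`. -/
noncomputable def fracDiscLap (s h : ℝ) (u : ℤ → ℝ) (j : ℤ) : ℝ :=
  h ^ (-(2 * s)) * ∑' m : ℤ, (u j - u m) * Ks s (j - m)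

/-- Forward difference `D_+ u_j = (u_{j+1} − u_j)/h`. -/
noncomputable def Dp (h : ℝ) (u : ℤ → ℝ) (j : ℤ) : ℝ := (u (j + 1) - u j) / h

/-- Backward difference `D_− u_j = (u_j − u_{j−1})/h`. -/
noncomputable def Dm (h : ℝ) (u : ℤ → ℝ) (j : ℤ) : ℝ := (u j - u (j - 1)) / h

/-- The ratio `Γ(k+1-s) / Γ(k+1+s)`. -/
noncomputable def gammaRatio (s : ℝ) (k : ℕ) : ℝ :=
  Real.Gamma (k + 1 - s) / Real.Gamma (k + 1 + s)

lemma gammaRatio_pos {s : ℝ} (hs0 : 0 < s) (hs1 : s < 1) (k : ℕ) : 0 < gammaRatio s k := by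
  have hk : (0 : ℝ) ≤ k := k.cast_nonneg
  exact div_pos (Real.Gamma_pos_of_pos (by linarith)) (Real.Gamma_pos_of_pos (by linarith))

lemma gammaRatio_succ {s : ℝ} (hs0 : 0 < s) (hs1 : s < 1) (k : ℕ) :
    gammaRatio s (k + 1) = gammaRatio s k * ((k + 1 - s) / (k + 1 + s)) := by
  have hk : (0 : ℝ) ≤ k := k.cast_nonneg
  have h1 : (k + 1 - s : ℝ) ≠ 0 := by linarith
  have h2 : (k + 1 + s : ℝ) ≠ 0 := by linarith
  have e1 : ((k + 1 : ℕ) : ℝ) + 1 - s = (k + 1 - s) + 1 := by push_cast; ring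
  have e2 : ((k + 1 : ℕ) : ℝ) + 1 + s = (k + 1 + s) + 1 := by push_cast; ring
  rw [gammaRatio, gammaRatio, e1, e2, Real.Gamma_add_one h1, Real.Gamma_add_one h2,
    mul_div_mul_comm, mul_comm]

lemma gammaRatio_sub_succ {s : ℝ} (hs0 : 0 < s) (hs1 : s < 1) (k : ℕ) :
    gammaRatio s k / (k + 1 + s) = (gammaRatio s k - gammaRatio s (k + 1)) / (2 * s) := by
  have hk : (0 : ℝ) ≤ k := k.cast_nonneg
  have h2 : (k + 1 + s : ℝ) ≠ 0 := by linarith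
  rw [gammaRatio_succ hs0 hs1]
  field_simp
  ring

lemma gammaRatio_le {s : ℝ} (hs0 : 0 < s) (hs2 : 2 * s ≤ 1) (k : ℕ) :
    gammaRatio s k ≤ gammaRatio s 0 * ((k : ℝ) + 1) ^ (-(2 * s)) := by
  induction k with
  | zero => simp
  | succ k ih =>
    have hk : (0 : ℝ) ≤ k := k.cast_nonneg
    have hx : (0 : ℝ) < k + 1 := by linarith
    have hb : (1 + 1 / ((k : ℝ) + 1)) ^ (2 * s) ≤ 1 + 2 * s * (1 / ((k : ℝ) + 1)) :=
      rpow_one_add_le_one_add_mul_self (by linarith [one_div_pos.2 hx]) (by linarith) hs2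
    have hsplit : ((k + 1 : ℕ) : ℝ) + 1 = (k + 1) * (1 + 1 / ((k : ℝ) + 1)) := by
      push_cast; field_simp
    have hpos : 0 < 1 + 1 / ((k : ℝ) + 1) := by positivity
    have hstep : ((k + 1 - s) / (k + 1 + s) : ℝ) ≤ (1 + 1 / ((k : ℝ) + 1)) ^ (-(2 * s)) := by
      rw [rpow_neg hpos.le, ← one_div, div_le_div_iff₀ (by linarith) (by positivity), one_mul]
      calc ((k : ℝ) + 1 - s) * (1 + 1 / ((k : ℝ) + 1)) ^ (2 * s)
          ≤ (k + 1 - s) * (1 + 2 * s * (1 / ((k : ℝ) + 1))) :=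
            mul_le_mul_of_nonneg_left hb (by linarith)
        _ = k + 1 + s - 2 * s ^ 2 / (k + 1) := by field_simp; ring
        _ ≤ k + 1 + s := by
            have : 0 ≤ 2 * s ^ 2 / ((k : ℝ) + 1) := by positivity
            linarith
    rw [gammaRatio_succ hs0 (by linarith), hsplit, mul_rpow hx.le hpos.le, ← mul_assoc]
    exact mul_le_mul ih hstep (div_nonneg (by linarith) (by linarith))
      (mul_nonneg (gammaRatio_pos hs0 (by linarith) 0).le (by positivity))

lemma mul_rpow_sub_one_le {γ : ℝ} (h0 : 0 ≤ γ) (h1 : γ ≤ 1) (k : ℕ) :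
    γ * ((k : ℝ) + 1) ^ (γ - 1) ≤ ((k + 1 : ℕ) : ℝ) ^ γ - (k : ℝ) ^ γ := by
  have hk : (0 : ℝ) ≤ k := k.cast_nonneg
  have hx : (0 : ℝ) < k + 1 := by linarith
  have hle : 1 / ((k : ℝ) + 1) ≤ 1 := by rw [div_le_one hx]; linarith
  have hb : (1 + -(1 / ((k : ℝ) + 1))) ^ γ ≤ 1 + γ * -(1 / ((k : ℝ) + 1)) :=
    rpow_one_add_le_one_add_mul_self (by linarith) h0 h1
  have hsplit : (k : ℝ) = (k + 1) * (1 + -(1 / ((k : ℝ) + 1))) := by field_simp; ring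
  have hle' : (k : ℝ) ^ γ ≤ ((k : ℝ) + 1) ^ γ * (1 + γ * -(1 / ((k : ℝ) + 1))) := by
    calc (k : ℝ) ^ γ = ((k + 1) * (1 + -(1 / ((k : ℝ) + 1)))) ^ γ := by rw [← hsplit]
      _ = ((k : ℝ) + 1) ^ γ * (1 + -(1 / ((k : ℝ) + 1))) ^ γ :=
          mul_rpow hx.le (by linarith)
      _ ≤ _ := mul_le_mul_of_nonneg_left hb (by positivity)
  have e : ((k : ℝ) + 1) ^ γ * (1 + γ * -(1 / ((k : ℝ) + 1)))
      = ((k : ℝ) + 1) ^ γ - γ * ((k : ℝ) + 1) ^ (γ - 1) := by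
    rw [rpow_sub_one hx.ne']; ring
  push_cast
  linarith

/-- The truncated moments of the kernel `Γ(m-s) / Γ(m+1+s)`. -/
lemma sum_range_min_mul_gammaRatio_le {s β R : ℝ} (hs0 : 0 < s) (hsβ : 2 * s < β) (hβ1 : β ≤ 1)
    (hR : 0 < R) (N : ℕ) :
    ∑ k ∈ Finset.range N, min (((k : ℝ) + 1) ^ β) (R ^ β) * (gammaRatio s k / (k + 1 + s)) ≤
      gammaRatio s 0 * (1 / (β - 2 * s) + 1 / (2 * s)) * R ^ (β - 2 * s) := by
  have hs1 : s < 1 := by linarith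
  have hγ : 0 < β - 2 * s := by linarith
  have hg := gammaRatio_pos hs0 hs1
  set n := ⌊R⌋₊ with hn
  have hnR : (n : ℝ) ≤ R := Nat.floor_le hR.le
  have hRn : R < n + 1 := Nat.lt_floor_add_one R
  have hκ : ∀ k : ℕ, 0 ≤ gammaRatio s k / (k + 1 + s) := fun k =>
    div_nonneg (hg k).le (by positivity)
  have hnear : ∑ k ∈ Finset.range n,
      min (((k : ℝ) + 1) ^ β) (R ^ β) * (gammaRatio s k / (k + 1 + s)) ≤
      gammaRatio s 0 * (1 / (β - 2 * s)) * R ^ (β - 2 * s) := by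
    calc _ ≤ ∑ k ∈ Finset.range n, gammaRatio s 0 * (1 / (β - 2 * s)) *
          (((k + 1 : ℕ) : ℝ) ^ (β - 2 * s) - (k : ℝ) ^ (β - 2 * s)) := by
          refine Finset.sum_le_sum fun k _ => ?_
          have hx : (0 : ℝ) < k + 1 := by positivity
          calc _ ≤ ((k : ℝ) + 1) ^ β * (gammaRatio s 0 * ((k : ℝ) + 1) ^ (-(2 * s)) / (k + 1)) := by
                refine mul_le_mul (min_le_left _ _) ?_ (hκ k) (by positivity)
                exact div_le_div₀ (mul_nonneg (hg 0).le (by positivity))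
                  (gammaRatio_le hs0 (by linarith) k) hx (by linarith)
            _ = gammaRatio s 0 * (1 / (β - 2 * s)) *
                  ((β - 2 * s) * ((k : ℝ) + 1) ^ (β - 2 * s - 1)) := by
                rw [rpow_sub_one hx.ne', sub_eq_add_neg β, rpow_add hx, ← sub_eq_add_neg]
                field_simp
            _ ≤ _ := mul_le_mul_of_nonneg_left (mul_rpow_sub_one_le hγ.le (by linarith) k)
                (mul_nonneg (hg 0).le (by positivity))
      _ = gammaRatio s 0 * (1 / (β - 2 * s)) * (n : ℝ) ^ (β - 2 * s) := by
          rw [← Finset.mul_sum, Finset.sum_range_sub (fun k : ℕ => (k : ℝ) ^ (β - 2 * s))]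
          simp [zero_rpow hγ.ne']
      _ ≤ _ := mul_le_mul_of_nonneg_left (rpow_le_rpow (by positivity) hnR hγ.le)
          (mul_nonneg (hg 0).le (by positivity))
  have hfar : ∑ i ∈ Finset.range N,
      min ((((n + i : ℕ) : ℝ) + 1) ^ β) (R ^ β) *
        (gammaRatio s (n + i) / (((n + i : ℕ) : ℝ) + 1 + s)) ≤
      gammaRatio s 0 * (1 / (2 * s)) * R ^ (β - 2 * s) := by
    calc _ ≤ ∑ i ∈ Finset.range N, R ^ β / (2 * s) *
          (gammaRatio s (n + i) - gammaRatio s (n + (i + 1))) := by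
          refine Finset.sum_le_sum fun i _ => ?_
          refine (mul_le_mul_of_nonneg_right (min_le_right _ _) (hκ _)).trans (le_of_eq ?_)
          rw [gammaRatio_sub_succ hs0 hs1, add_assoc]
          ring
      _ = R ^ β / (2 * s) * (gammaRatio s n - gammaRatio s (n + N)) := by
          rw [← Finset.mul_sum, Finset.sum_range_sub' (fun i => gammaRatio s (n + i))]
          simp
      _ ≤ R ^ β / (2 * s) * (gammaRatio s 0 * R ^ (-(2 * s))) := by
          refine mul_le_mul_of_nonneg_left ?_ (by positivity)
          have h1 := gammaRatio_le hs0 (by linarith) n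
          have h2 : ((n : ℝ) + 1) ^ (-(2 * s)) ≤ R ^ (-(2 * s)) :=
            rpow_le_rpow_of_nonpos hR hRn.le (by linarith)
          have h3 := mul_le_mul_of_nonneg_left h2 (hg 0).le
          linarith [hg (n + N)]
      _ = _ := by rw [sub_eq_add_neg, rpow_add hR]; ring
  calc _ ≤ ∑ k ∈ Finset.range (n + N),
        min (((k : ℝ) + 1) ^ β) (R ^ β) * (gammaRatio s k / (k + 1 + s)) :=
        Finset.sum_le_sum_of_subset_of_nonneg (Finset.range_mono (by omega))
          fun k _ _ => mul_nonneg (by positivity) (hκ k)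
    _ ≤ _ := by rw [Finset.sum_range_add]; linarith

lemma Ks_neg (s : ℝ) (m : ℤ) : Ks s (-m) = Ks s m := by simp [Ks]

lemma Ks_natCast_add_one (s : ℝ) (hs0 : 0 < s) (k : ℕ) :
    Ks s ((k : ℤ) + 1) = 4 ^ s * Real.Gamma (1 / 2 + s) / (Real.sqrt Real.pi * |Real.Gamma (-s)|) *
      (gammaRatio s k / (k + 1 + s)) := by
  have hx : (0 : ℝ) < k + 1 + s := by positivity
  have h0 : ((k : ℤ) + 1) ≠ 0 := by omega
  have habs : |(((k : ℤ) + 1 : ℤ) : ℝ)| = k + 1 := by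
    push_cast; exact abs_of_pos (by positivity)
  have e : (k : ℝ) + 1 + 1 + s = (k + 1 + s) + 1 := by ring
  rw [Ks, if_neg h0, habs, gammaRatio, e, Real.Gamma_add_one hx.ne', div_div, div_mul_div_comm]
  congr 1
  ring

lemma Ks_nonneg {s : ℝ} (hs0 : 0 < s) (hs1 : s < 1) (m : ℤ) : 0 ≤ Ks s m := by
  rw [Ks]
  split_ifs with hm
  · exact le_rfl
  · have h1 : (1 : ℝ) ≤ |(m : ℝ)| := by exact_mod_cast Int.one_le_abs hm
    have := Real.Gamma_pos_of_pos (show 0 < |(m : ℝ)| - s by linarith)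
    have := Real.Gamma_pos_of_pos (show 0 < |(m : ℝ)| + 1 + s by linarith)
    have := Real.Gamma_pos_of_pos (show 0 < 1 / 2 + s by linarith)
    positivity

/-- The truncated moments `∑ min(|m|, R)^β K_s(m)` grow at most like `R^(β-2s)`. -/
lemma exists_tsum_min_mul_Ks_le {s β : ℝ} (hs0 : 0 < s) (hsβ : 2 * s < β) (hβ1 : β ≤ 1) :
    ∃ C : ℝ, 0 < C ∧ ∀ R : ℝ, 0 < R →
      Summable (fun m : ℤ => min (|(m : ℝ)| ^ β) (R ^ β) * Ks s m) ∧
      ∑' m : ℤ, min (|(m : ℝ)| ^ β) (R ^ β) * Ks s m ≤ C * R ^ (β - 2 * s) := by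
  have hs1 : s < 1 := by linarith
  set c := 4 ^ s * Real.Gamma (1 / 2 + s) / (Real.sqrt Real.pi * |Real.Gamma (-s)|) with hc
  have hc0 : 0 ≤ c := by
    have := Real.Gamma_pos_of_pos (show 0 < 1 / 2 + s by linarith)
    positivity
  set D := gammaRatio s 0 * (1 / (β - 2 * s) + 1 / (2 * s)) with hD
  have hD0 : 0 ≤ D := by
    have := gammaRatio_pos hs0 hs1 0
    have : 0 < β - 2 * s := by linarith
    positivity
  refine ⟨2 * (c * D) + 1, by positivity, fun R hR => ?_⟩
  set F : ℤ → ℝ := fun m => min (|(m : ℝ)| ^ β) (R ^ β) * Ks s m with hF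
  have hF0 : ∀ m, 0 ≤ F m := fun m => mul_nonneg (by positivity) (Ks_nonneg hs0 hs1 m)
  have hneg : (fun n : ℕ => F (-((n : ℤ) + 1))) = fun n : ℕ => F ((n : ℤ) + 1) := by
    funext n
    simp only [hF]
    rw [Ks_neg, Int.cast_neg, abs_neg]
  have hpart : ∀ N : ℕ, ∑ k ∈ Finset.range N, F ((k : ℤ) + 1) ≤ c * (D * R ^ (β - 2 * s)) := by
    intro N
    refine le_trans (le_of_eq ?_) (mul_le_mul_of_nonneg_left
      (sum_range_min_mul_gammaRatio_le hs0 hsβ hβ1 hR N) hc0)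
    rw [Finset.mul_sum]
    refine Finset.sum_congr rfl fun k _ => ?_
    have habs : |(((k : ℤ) + 1 : ℤ) : ℝ)| = k + 1 := by
      push_cast; exact abs_of_pos (by positivity)
    simp only [hF]
    rw [Ks_natCast_add_one s hs0, habs]
    ring
  have hsum : Summable fun n : ℕ => F ((n : ℤ) + 1) :=
    summable_of_sum_range_le (fun n => hF0 _) hpart
  have hle : ∑' n : ℕ, F ((n : ℤ) + 1) ≤ c * (D * R ^ (β - 2 * s)) :=
    Real.tsum_le_of_sum_range_le (fun n => hF0 _) hpart
  have hzero : F 0 = 0 := by simp [hF, Ks]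
  refine ⟨Summable.of_add_one_of_neg_add_one hsum (hneg ▸ hsum), ?_⟩
  rw [tsum_of_add_one_of_neg_add_one hsum (hneg ▸ hsum), hneg, hzero]
  have : 0 ≤ R ^ (β - 2 * s) := by positivity
  linarith

lemma summable_mul_Ks_and_abs_tsum_le {s β R B C L : ℝ} (hs0 : 0 < s) (hs1 : s < 1)
    (hsum : Summable (fun m : ℤ => min (|(m : ℝ)| ^ β) (R ^ β) * Ks s m))
    (hle : ∑' m : ℤ, min (|(m : ℝ)| ^ β) (R ^ β) * Ks s m ≤ B) (hL : 0 ≤ L)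
    (hB : L * B ≤ C) (w : ℤ → ℝ) (hw : ∀ m, |w m| ≤ L * min (|(m : ℝ)| ^ β) (R ^ β)) :
    Summable (fun m => w m * Ks s m) ∧ |∑' m, w m * Ks s m| ≤ C := by
  have hbound : ∀ m, ‖w m * Ks s m‖ ≤ L * (min (|(m : ℝ)| ^ β) (R ^ β) * Ks s m) := by
    intro m
    rw [norm_mul, Real.norm_eq_abs, Real.norm_of_nonneg (Ks_nonneg hs0 hs1 m), ← mul_assoc]
    exact mul_le_mul_of_nonneg_right (hw m) (Ks_nonneg hs0 hs1 m)
  refine ⟨(hsum.mul_left L).of_norm_bounded hbound, ?_⟩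
  refine (tsum_of_norm_bounded (hsum.mul_left L).hasSum hbound).trans ?_
  rw [tsum_mul_left]
  exact (mul_le_mul_of_nonneg_left hle hL).trans hB

lemma fracDiscLap_eq_tsum_sub (s h : ℝ) (u : ℤ → ℝ) (j : ℤ) :
    fracDiscLap s h u j = h ^ (-(2 * s)) * ∑' m : ℤ, (u j - u (j - m)) * Ks s m := by
  rw [fracDiscLap, ← (Equiv.subLeft j).tsum_eq]
  simp

/-- The difference of a bounded `β`-Hölder function is controlled by `min(|m|, 1/h)^β`. -/
lemma abs_sub_le_mul_min {β h A B : ℝ} (hh : 0 < h) (hA : 0 ≤ A) (hB : 0 ≤ B)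
    {v : ℤ → ℝ} (hvA : ∀ j, |v j| ≤ A)
    (hvB : ∀ j m : ℤ, |v j - v m| ≤ (2 * A + B) * (h * |(j : ℝ) - (m : ℝ)|) ^ β) (j m : ℤ) :
    |v j - v (j - m)| ≤ (2 * A + B) * h ^ β * min (|(m : ℝ)| ^ β) ((1 / h) ^ β) := by
  rw [mul_assoc, mul_min_of_nonneg _ _ (by positivity), mul_min_of_nonneg _ _ (by positivity),
    ← mul_rpow hh.le (abs_nonneg _), ← mul_rpow hh.le (by positivity), mul_one_div_cancel hh.ne',
    one_rpow]
  refine le_min ?_ ?_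
  · simpa using hvB j (j - m)
  · have := abs_sub (v j) (v (j - m))
    linarith [hvA j, hvA (j - m)]

/-- A bounded Lipschitz function is `β`-Hölder for `β ≤ 1`. -/
lemma abs_sub_le_of_bounded_of_lipschitz {β h A B : ℝ} (hβ0 : 0 < β) (hβ1 : β ≤ 1) (hh : 0 < h)
    (hA : 0 ≤ A) (hB : 0 ≤ B) {u : ℤ → ℝ} (huA : ∀ j, |u j| ≤ A) (huB : ∀ j, |Dp h u j| ≤ B)
    (j m : ℤ) : |u j - u m| ≤ (2 * A + B) * (h * |(j : ℝ) - (m : ℝ)|) ^ β := by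
  have hnat : ∀ (n : ℕ) (i : ℤ), |u (i + n) - u i| ≤ B * (h * n) := by
    intro n i
    induction n with
    | zero => simp
    | succ n ih =>
      have h1 := huB (i + n)
      rw [Dp, abs_div, abs_of_pos hh, div_le_iff₀ hh] at h1
      have h2 := abs_sub_le (u (i + n + 1)) (u (i + n)) (u i)
      have e : i + ((n + 1 : ℕ) : ℤ) = i + n + 1 := by push_cast; ring
      rw [e]
      push_cast
      linarith
  have hlip : |u j - u m| ≤ B * (h * |(j : ℝ) - (m : ℝ)|) := by
    rcases le_total m j with hjm | hjm
    · obtain ⟨n, rfl⟩ := Int.le.dest hjm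
      simpa using hnat n m
    · obtain ⟨n, rfl⟩ := Int.le.dest hjm
      rw [abs_sub_comm]
      simpa using hnat n j
  have hx : 0 ≤ h * |(j : ℝ) - (m : ℝ)| := by positivity
  rcases le_total (h * |(j : ℝ) - (m : ℝ)|) 1 with h1 | h1
  · have h2 : h * |(j : ℝ) - (m : ℝ)| ≤ (h * |(j : ℝ) - (m : ℝ)|) ^ β :=
      self_le_rpow_of_le_one hx h1 hβ1
    calc _ ≤ B * (h * |(j : ℝ) - (m : ℝ)|) := hlip
      _ ≤ _ := mul_le_mul (by linarith) h2 hx (by linarith)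
  · have h2 : 1 ≤ (h * |(j : ℝ) - (m : ℝ)|) ^ β := one_le_rpow h1 hβ0.le
    have h3 := abs_sub (u j) (u m)
    have h4 := le_mul_of_one_le_right (show 0 ≤ 2 * A + B by linarith) h2
    linarith [huA j, huA m]

/-- The fractional discrete Laplacian of a bounded `β`-Hölder function is bounded and
`(β-2s)`-Hölder when `2s < β`. -/
lemma exists_fracDiscLap_bound {s β : ℝ} (hs0 : 0 < s) (hsβ : 2 * s < β) (hβ1 : β ≤ 1) :
    ∃ C : ℝ, 0 < C ∧ ∀ (h : ℝ), 0 < h → ∀ (v : ℤ → ℝ) (A B : ℝ), 0 ≤ A → 0 ≤ B →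
      (∀ j, |v j| ≤ A) →
      (∀ j m : ℤ, |v j - v m| ≤ (2 * A + B) * (h * |(j : ℝ) - (m : ℝ)|) ^ β) →
      (∀ j, Summable fun m : ℤ => (v j - v (j - m)) * Ks s m) ∧
      (∀ j, |fracDiscLap s h v j| ≤ C * (2 * A + B)) ∧
      (∀ j m : ℤ, |fracDiscLap s h v j - fracDiscLap s h v m| ≤
        2 * C * (2 * A + B) * (h * |(j : ℝ) - (m : ℝ)|) ^ (β - 2 * s)) := by
  have hs1 : s < 1 := by linarith
  obtain ⟨C, hC, hK⟩ := exists_tsum_min_mul_Ks_le hs0 hsβ hβ1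
  refine ⟨C, hC, fun h hh v A B hA hB hvA hvB => ?_⟩
  set Λ := 2 * A + B with hΛ
  have hΛ0 : 0 ≤ Λ := by positivity
  have hpow : h ^ (-(2 * s)) * h ^ β = h ^ (β - 2 * s) := by
    rw [← rpow_add hh]; congr 1; ring
  have hloc := fun j => summable_mul_Ks_and_abs_tsum_le hs0 hs1 (hK (1 / h) (by positivity)).1
    (hK (1 / h) (by positivity)).2 (by positivity) le_rfl _
    (abs_sub_le_mul_min hh hA hB hvA hvB j)
  refine ⟨fun j => (hloc j).1, fun j => ?_, fun j m => ?_⟩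
  · rw [fracDiscLap_eq_tsum_sub, abs_mul, abs_of_pos (by positivity)]
    refine (mul_le_mul_of_nonneg_left (hloc j).2 (by positivity)).trans (le_of_eq ?_)
    calc _ = C * Λ * ((h ^ (-(2 * s)) * h ^ β) * (1 / h) ^ (β - 2 * s)) := by ring
      _ = C * Λ := by
        rw [hpow, ← mul_rpow hh.le (by positivity), mul_one_div_cancel hh.ne', one_rpow, mul_one]
  · rcases eq_or_ne j m with rfl | hjm
    · simp only [sub_self, abs_zero]
      positivity
    have hR : 0 < |(j : ℝ) - (m : ℝ)| := abs_pos.2 (sub_ne_zero.2 (by exact_mod_cast hjm))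
    have hw : ∀ i : ℤ, |(v j - v (j - i)) - (v m - v (m - i))| ≤
        2 * Λ * h ^ β * min (|(i : ℝ)| ^ β) (|(j : ℝ) - (m : ℝ)| ^ β) := by
      intro i
      have e1 := hvB j (j - i)
      have e2 := hvB m (m - i)
      have e3 := hvB j m
      have e4 := hvB (j - i) (m - i)
      push_cast at e1 e2 e4
      rw [sub_sub_cancel, mul_rpow hh.le (abs_nonneg _)] at e1 e2
      rw [sub_sub_sub_cancel_right] at e4
      rw [mul_rpow hh.le (abs_nonneg _)] at e3 e4
      rw [mul_min_of_nonneg _ _ (by positivity)]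
      refine le_min ?_ ?_
      · have := abs_sub (v j - v (j - i)) (v m - v (m - i))
        linarith
      · have := abs_sub (v j - v m) (v (j - i) - v (m - i))
        rw [sub_sub_sub_comm]
        linarith
    have hmain := (summable_mul_Ks_and_abs_tsum_le hs0 hs1 (hK _ hR).1
      (hK _ hR).2 (by positivity) le_rfl _ hw).2
    rw [fracDiscLap_eq_tsum_sub, fracDiscLap_eq_tsum_sub, ← mul_sub,
      ← (hloc j).1.tsum_sub (hloc m).1, abs_mul, abs_of_pos (by positivity)]
    simp only [← sub_mul]
    refine (mul_le_mul_of_nonneg_left hmain (by positivity)).trans (le_of_eq ?_)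
    rw [mul_rpow hh.le hR.le, ← hpow]
    ring

lemma Dp_fracDiscLap (s h : ℝ) (u : ℤ → ℝ)
    (hu : ∀ j, Summable fun m : ℤ => (u j - u (j - m)) * Ks s m) (j : ℤ) :
    Dp h (fracDiscLap s h u) j = fracDiscLap s h (Dp h u) j := by
  rw [Dp, fracDiscLap_eq_tsum_sub, fracDiscLap_eq_tsum_sub, fracDiscLap_eq_tsum_sub, ← mul_sub,
    ← (hu (j + 1)).tsum_sub (hu j), mul_div_assoc, ← tsum_div_const]
  congr 2
  funext m
  rw [Dp, Dp, show j - m + 1 = j + 1 - m by ring]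
  ring

lemma Dm_eq_Dp_sub_one (h : ℝ) (u : ℤ → ℝ) (j : ℤ) : Dm h u j = Dp h u (j - 1) := by
  simp [Dm, Dp]

/-- Hölder regularity of the fractional discrete Laplacian: `C_h^{1,β} → C_h^{1,β−2s}`
when `2s < β`.  Here `M₀, M₊, M₋` bound `sup |u|`, `sup |D_+u|`, `sup |D_−u|`
and `L₊, L₋` bound the seminorms `[D_+u]_{C_h^{0,β}}`, `[D_−u]_{C_h^{0,β}}`. -/
theorem fracDiscLap_Holder_C1 (β s : ℝ) (hβ0 : 0 < β) (hβ1 : β ≤ 1)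
    (hs0 : 0 < s) (hs1 : s < 1) (hsβ : 2 * s < β) :
    ∃ C : ℝ, 0 < C ∧ ∀ (h : ℝ), 0 < h → ∀ (u : ℤ → ℝ) (M₀ Mp Mm Lp Lm : ℝ),
      (∀ j : ℤ, |u j| ≤ M₀) →
      (∀ j : ℤ, |Dp h u j| ≤ Mp) →
      (∀ j : ℤ, |Dm h u j| ≤ Mm) →
      (∀ j m : ℤ, |Dp h u j - Dp h u m| ≤ Lp * (h * |(j : ℝ) - (m : ℝ)|) ^ β) →
      (∀ j m : ℤ, |Dm h u j - Dm h u m| ≤ Lm * (h * |(j : ℝ) - (m : ℝ)|) ^ β) →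
      (∀ j : ℤ, |fracDiscLap s h u j| ≤ C * (M₀ + Mp + Mm + Lp + Lm)) ∧
      (∀ j : ℤ, |Dp h (fracDiscLap s h u) j| ≤ C * (M₀ + Mp + Mm + Lp + Lm)) ∧
      (∀ j : ℤ, |Dm h (fracDiscLap s h u) j| ≤ C * (M₀ + Mp + Mm + Lp + Lm)) ∧
      (∀ j m : ℤ, |Dp h (fracDiscLap s h u) j - Dp h (fracDiscLap s h u) m| ≤
        C * (M₀ + Mp + Mm + Lp + Lm) * (h * |(j : ℝ) - (m : ℝ)|) ^ (β - 2 * s)) ∧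
      (∀ j m : ℤ, |Dm h (fracDiscLap s h u) j - Dm h (fracDiscLap s h u) m| ≤
        C * (M₀ + Mp + Mm + Lp + Lm) * (h * |(j : ℝ) - (m : ℝ)|) ^ (β - 2 * s)) := by
  obtain ⟨C, hC, hbd⟩ := exists_fracDiscLap_bound hs0 hsβ hβ1
  refine ⟨4 * C, by positivity, fun h hh u M₀ Mp Mm Lp Lm hu hp hm hLp hLm => ?_⟩
  have hM₀ : 0 ≤ M₀ := (abs_nonneg _).trans (hu 0)
  have hMp : 0 ≤ Mp := (abs_nonneg _).trans (hp 0)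
  have hMm : 0 ≤ Mm := (abs_nonneg _).trans (hm 0)
  have hseminorm : ∀ {L : ℝ} {v : ℤ → ℝ},
      (∀ j m : ℤ, |v j - v m| ≤ L * (h * |(j : ℝ) - (m : ℝ)|) ^ β) → 0 ≤ L := by
    intro L v hv
    have h1 := (abs_nonneg _).trans (hv 1 0)
    simp only [Int.cast_one, Int.cast_zero, sub_zero, abs_one, mul_one] at h1
    exact nonneg_of_mul_nonneg_left h1 (by positivity)
  have hLp0 : 0 ≤ Lp := hseminorm hLp
  have hLm0 : 0 ≤ Lm := hseminorm hLm
  obtain ⟨hsum, hsup, -⟩ := hbd h hh u M₀ Mp hM₀ hMp hu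
    (abs_sub_le_of_bounded_of_lipschitz hβ0 hβ1 hh hM₀ hMp hu hp)
  obtain ⟨-, hDsup, hDhol⟩ := hbd h hh (Dp h u) Mp Lp hMp hLp0 hp fun j m =>
    (hLp j m).trans (mul_le_mul_of_nonneg_right (by linarith) (by positivity))
  have hDp : ∀ j, |Dp h (fracDiscLap s h u) j| ≤ 4 * C * (M₀ + Mp + Mm + Lp + Lm) := fun j => by
    rw [Dp_fracDiscLap s h u hsum]
    exact (hDsup j).trans (by nlinarith)
  have hDpHol : ∀ j m : ℤ, |Dp h (fracDiscLap s h u) j - Dp h (fracDiscLap s h u) m| ≤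
      4 * C * (M₀ + Mp + Mm + Lp + Lm) * (h * |(j : ℝ) - (m : ℝ)|) ^ (β - 2 * s) := fun j m => by
    rw [Dp_fracDiscLap s h u hsum, Dp_fracDiscLap s h u hsum]
    exact (hDhol j m).trans (mul_le_mul_of_nonneg_right (by nlinarith) (by positivity))
  refine ⟨fun j => (hsup j).trans (by nlinarith), hDp, fun j => ?_, hDpHol, fun j m => ?_⟩
  · rw [Dm_eq_Dp_sub_one]
    exact hDp _
  · rw [Dm_eq_Dp_sub_one, Dm_eq_Dp_sub_one]
    simpa using hDpHol (j - 1) (m - 1)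
end

section
/- Let 0<s<1. There exists a constant C_s>0 depending only on s such that for every integer m ≥ 1, | Γ(m−s)/Γ(m+1+s) − 1/m^{1+2s} | ≤ C_s / m^{2+2s}. -/
open Real

/-- **Wendel's inequality**, a consequence of the log-convexity of the Gamma function. -/
theorem Gamma_add_le_rpow_mul_Gamma {x a : ℝ} (hx : 0 < x) (ha0 : 0 < a) (ha1 : a < 1) :
    Gamma (x + a) ≤ x ^ a * Gamma x := by
  have hG := Gamma_pos_of_pos hx
  have h := Gamma_mul_add_mul_le_rpow_Gamma_mul_rpow_Gamma hx (by linarith : 0 < x + 1)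
    (by linarith : 0 < 1 - a) ha0 (by ring)
  rw [Gamma_add_one hx.ne', mul_rpow hx.le hG.le] at h
  calc Gamma (x + a) = Gamma ((1 - a) * x + a * (x + 1)) := by congr 1; ring
    _ ≤ _ := h
    _ = x ^ a * (Gamma x ^ (1 - a) * Gamma x ^ a) := by ring
    _ = x ^ a * Gamma x := by rw [← rpow_add hG]; simp

theorem add_rpow_le_rpow_mul_one_add_div {x t a : ℝ} (hx : 0 < x) (ht : 0 ≤ t) (ha1 : a ≤ 1) :
    (x + t) ^ a ≤ x ^ a * (1 + t / x) := by
  have h1 : 1 ≤ 1 + t / x := le_add_of_nonneg_right (by positivity)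
  calc (x + t) ^ a = (x * (1 + t / x)) ^ a := by congr 1; field_simp
    _ = x ^ a * (1 + t / x) ^ a := mul_rpow hx.le (by positivity)
    _ ≤ x ^ a * (1 + t / x) ^ (1 : ℝ) := by gcongr
    _ = x ^ a * (1 + t / x) := by rw [rpow_one]

theorem rpow_mul_Gamma_le_mul_Gamma {x s : ℝ} (hx : 0 < x) (hs0 : 0 < s) (hs1 : s < 1) :
    x ^ (2 * s) * Gamma (x + (1 - s)) ≤ (x + s) * Gamma (x + s) := by
  have hB := Gamma_pos_of_pos (by linarith : 0 < x + s)
  have h1 := Gamma_add_le_rpow_mul_Gamma hx (by linarith : 0 < 1 - s) (by linarith)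
  have h2 := Gamma_add_le_rpow_mul_Gamma (by linarith : 0 < x + s) (by linarith : 0 < 1 - s)
    (by linarith)
  have h3 := add_rpow_le_rpow_mul_one_add_div hx hs0.le (by linarith : 1 - s ≤ 1)
  rw [show x + s + (1 - s) = x + 1 by ring, Gamma_add_one hx.ne'] at h2
  have e1 : x ^ (2 * s) * x ^ (1 - s) = x * x ^ s := by
    rw [← rpow_add hx, ← rpow_one_add' hx.le (by linarith)]; congr 1; ring
  have e2 : x ^ s * x ^ (1 - s) = x := by rw [← rpow_add hx]; simp
  calc x ^ (2 * s) * Gamma (x + (1 - s)) ≤ x ^ (2 * s) * (x ^ (1 - s) * Gamma x) := by gcongr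
    _ = x ^ s * (x * Gamma x) := by rw [← mul_assoc, e1]; ring
    _ ≤ x ^ s * ((x ^ (1 - s) * (1 + s / x)) * Gamma (x + s)) := by
        refine mul_le_mul_of_nonneg_left (h2.trans ?_) (by positivity)
        gcongr
    _ = (x ^ s * x ^ (1 - s)) * (1 + s / x) * Gamma (x + s) := by ring
    _ = (x + s) * Gamma (x + s) := by rw [e2]; field_simp

theorem sq_mul_Gamma_le_rpow_mul_Gamma {x s : ℝ} (hx : 0 < x) (hs0 : 0 < s) (hs1 : s < 1) :
    x ^ 2 * Gamma (x + s) ≤ x ^ (2 * s) * (x + 1) * Gamma (x + (1 - s)) := by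
  have hA := Gamma_pos_of_pos (by linarith : 0 < x + (1 - s))
  have h1 := Gamma_add_le_rpow_mul_Gamma hx hs0 hs1
  have h2 := Gamma_add_le_rpow_mul_Gamma (by linarith : 0 < x + (1 - s)) hs0 hs1
  have h3 := add_rpow_le_rpow_mul_one_add_div hx (by linarith : 0 ≤ 1 - s) hs1.le
  rw [show x + (1 - s) + s = x + 1 by ring, Gamma_add_one hx.ne'] at h2
  have e : x ^ s * x ^ s = x ^ (2 * s) := by rw [← rpow_add hx]; congr 1; ring
  calc x ^ 2 * Gamma (x + s) ≤ x ^ 2 * (x ^ s * Gamma x) := by gcongr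
    _ = x * x ^ s * (x * Gamma x) := by ring
    _ ≤ x * x ^ s * ((x ^ s * (1 + 1 / x)) * Gamma (x + (1 - s))) := by
        refine mul_le_mul_of_nonneg_left (h2.trans ?_) (by positivity)
        gcongr
        refine h3.trans ?_
        gcongr
        linarith
    _ = (x ^ s * x ^ s) * (x * (1 + 1 / x)) * Gamma (x + (1 - s)) := by ring
    _ = x ^ (2 * s) * (x + 1) * Gamma (x + (1 - s)) := by rw [e]; field_simp

theorem gamma_ratio_laplacian_asymptotics (s : ℝ) (hs0 : 0 < s) (hs1 : s < 1) :
    ∃ C : ℝ, 0 < C ∧ ∀ m : ℕ, 1 ≤ m →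
      |Real.Gamma ((m : ℝ) - s) / Real.Gamma ((m : ℝ) + 1 + s) - 1 / (m : ℝ) ^ (1 + 2 * s)| ≤
        C / (m : ℝ) ^ (2 + 2 * s) := by
  have hs : 0 < 1 - s := by linarith
  refine ⟨1 / (1 - s), by positivity, fun m hm => ?_⟩
  have hx1 : (1 : ℝ) ≤ m := by exact_mod_cast hm
  generalize (m : ℝ) = x at hx1
  have hx : 0 < x := by linarith
  have hxs : 0 < x - s := by linarith
  have hxs' : 0 < x + s := by linarith
  have hU := rpow_mul_Gamma_le_mul_Gamma hx hs0 hs1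
  have hL := sq_mul_Gamma_le_rpow_mul_Gamma hx hs0 hs1
  have hA := Gamma_pos_of_pos (by linarith : 0 < x + (1 - s))
  have hB := Gamma_pos_of_pos hxs'
  have hP : 0 < x ^ (2 * s) := by positivity
  have eA : Gamma (x - s) = Gamma (x + (1 - s)) / (x - s) := by
    rw [show x + (1 - s) = x - s + 1 by ring, Gamma_add_one hxs.ne']; field_simp
  rw [eA, show x + 1 + s = x + s + 1 by ring, Gamma_add_one hxs'.ne', rpow_add hx, rpow_add hx,
    rpow_one, rpow_two]
  generalize Gamma (x + (1 - s)) = A at *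
  generalize Gamma (x + s) = B at *
  generalize x ^ (2 * s) = P at *
  have hR : A / (x - s) / ((x + s) * B) = P * A / ((x + s) * B) / (x - s) / P := by field_simp
  have hQU : P * A / ((x + s) * B) ≤ 1 := by rw [div_le_one (by positivity)]; exact hU
  have hQL : x ^ 2 / ((x + s) * (x + 1)) ≤ P * A / ((x + s) * B) := by
    rw [div_le_div_iff₀ (by positivity) (by positivity)]
    nlinarith [mul_le_mul_of_nonneg_left hL hxs'.le]
  generalize P * A / ((x + s) * B) = Q at *
  have e : Q / (x - s) / P - 1 / (x * P) = (Q / (x - s) - 1 / x) / P := by field_simp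
  have e' : 1 / (1 - s) / (x ^ 2 * P) = (1 / (1 - s) / x ^ 2) / P := by field_simp
  rw [hR, e, e', abs_div, abs_of_pos hP]
  gcongr
  rw [abs_le]
  constructor
  · have h1 : x ^ 2 / ((x + s) * (x + 1)) / (x - s) ≤ Q / (x - s) := by gcongr
    have h2 : 1 / (x + 1) ≤ x ^ 2 / ((x + s) * (x + 1)) / (x - s) := by
      rw [div_div, div_le_div_iff₀ (by positivity) (by positivity)]
      nlinarith [mul_nonneg (sq_nonneg s) (by linarith : 0 ≤ x + 1)]
    have h3 : 1 / x - 1 / x ^ 2 ≤ 1 / (x + 1) := by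
      rw [show 1 / x - 1 / x ^ 2 = (x - 1) / x ^ 2 by field_simp,
        div_le_div_iff₀ (by positivity) (by positivity)]
      nlinarith
    have h4 : 1 / x ^ 2 ≤ 1 / (1 - s) / x ^ 2 := by
      gcongr
      rw [le_div_iff₀ hs]; linarith
    linarith
  · have h1 : Q / (x - s) ≤ 1 / (x - s) := by gcongr
    have h2 : 1 / (x - s) - 1 / x ≤ 1 / (1 - s) / x ^ 2 := by
      rw [show 1 / (x - s) - 1 / x = s / ((x - s) * x) by field_simp; ring, div_div,
        div_le_div_iff₀ (by positivity) (by positivity)]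
      nlinarith [mul_nonneg hx.le (mul_nonneg hs.le (by linarith : 0 ≤ x - 1)),
        mul_nonneg hx.le (mul_nonneg hs.le (mul_nonneg hs.le (by linarith : 0 ≤ x))),
        mul_nonneg hx.le hs.le]
    linarith
end
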